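/- Sharp weak-type bound for the Riesz potential: Let 0 < α < n, 1 ≤ p < n/α, and define q by 1/q = 1/p − α/n. Then there is a constant c = c(n,α,p) such that for every weight w ∈ A_{p,q} and every measurable f, ‖I_α f‖_{L^{q,∞}(w^q)} ≤ c [w]_{A_{p,q}}^{1−α/n} ‖w·f‖_{L^{p}(ℝⁿ)}. -/

import Mathlib

open MeasureTheory ENNReal Set

noncomputable section

/-- Euclidean space `ℝⁿ`. -/
abbrev Euc (n : ℕ) := EuclideanSpace ℝ (Fin n)

variable {n : ℕ}

/-- The axis-parallel closed cube with lower corner `a` and side length `h`. -/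
def Cube (a : Euc n) (h : ℝ) : Set (Euc n) :=
  {x | ∀ i, a i ≤ x i ∧ x i ≤ a i + h}

/-- The weighted measure `u(E) = ∫_E u dx` of a set. -/
def wMeas (u : Euc n → ℝ) (E : Set (Euc n)) : ℝ≥0∞ :=
  ∫⁻ x in E, ENNReal.ofReal (u x)

/-- The dual exponent `p' = p/(p-1)`. -/
def dualExp (p : ℝ) : ℝ := p / (p - 1)

/-- The `A_{p,q}` constant of a weight `w` (with the `A_{1,q}` convention when `p = 1`). -/
def Apq (p q : ℝ) (w : Euc n → ℝ) : ℝ≥0∞ :=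
  ⨆ (a : Euc n) (h : ℝ) (_ : 0 < h),
    ((volume (Cube a h))⁻¹ * ∫⁻ x in Cube a h, ENNReal.ofReal (w x) ^ q) *
      (if p = 1 then
        (essSup (fun x => (ENNReal.ofReal (w x))⁻¹) (volume.restrict (Cube a h))) ^ q
      else
        ((volume (Cube a h))⁻¹ * ∫⁻ x in Cube a h,
            ENNReal.ofReal (w x) ^ (-(dualExp p))) ^ (q / dualExp p))

/-- The weighted Lebesgue norm `‖w f‖_{L^p(ℝⁿ)}`. -/
def wLp (w f : Euc n → ℝ) (p : ℝ) : ℝ≥0∞ :=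
  (∫⁻ x, (ENNReal.ofReal (w x) * ENNReal.ofReal |f x|) ^ p) ^ (1 / p)

/-- The weighted Lebesgue norm `‖w g‖_{L^q(ℝⁿ)}` of an `ℝ≥0∞`-valued function. -/
def wLpE (w : Euc n → ℝ) (g : Euc n → ℝ≥0∞) (q : ℝ) : ℝ≥0∞ :=
  (∫⁻ x, (ENNReal.ofReal (w x) * g x) ^ q) ^ (1 / q)

/-- The weak norm `‖g‖_{L^{q,∞}(u)} = sup_{λ>0} λ u({|g|>λ})^{1/q}`. -/
def weakLp (u : Euc n → ℝ) (g : Euc n → ℝ) (q : ℝ) : ℝ≥0∞ :=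
  ⨆ (t : ℝ) (_ : 0 < t), ENNReal.ofReal t * wMeas u {x | t < |g x|} ^ (1 / q)

/-- The weak norm of an `ℝ≥0∞`-valued function. -/
def weakLpE (u : Euc n → ℝ) (g : Euc n → ℝ≥0∞) (q : ℝ) : ℝ≥0∞ :=
  ⨆ (t : ℝ) (_ : 0 < t), ENNReal.ofReal t * wMeas u {x | ENNReal.ofReal t < g x} ^ (1 / q)

/-- The fractional integral (Riesz potential) `I_α f(x) = ∫ |f(y)| |x-y|^{α-n} dy`. -/
def riesz (α : ℝ) (f : Euc n → ℝ) (x : Euc n) : ℝ≥0∞ :=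
  ∫⁻ y, ENNReal.ofReal |f y| * ENNReal.ofReal (‖x - y‖ ^ (α - (n : ℝ)))

/-- The fractional maximal operator `M_α f(x) = sup_{Q ∋ x} |Q|^{α/n-1} ∫_Q |f|`. -/
def fracMax (α : ℝ) (f : Euc n → ℝ) (x : Euc n) : ℝ≥0∞ :=
  ⨆ (a : Euc n) (h : ℝ) (_ : 0 < h) (_ : x ∈ Cube a h),
    volume (Cube a h) ^ (α / (n : ℝ) - 1) * ∫⁻ y in Cube a h, ENNReal.ofReal |f y|




/-- Centered weighted maximal function (rational radii). -/
def Mc (μ : Measure (Euc n)) (g : Euc n → ℝ≥0∞) (x : Euc n) : ℝ≥0∞ :=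
  ⨆ r : {r : ℚ // 0 < r}, (μ (Metric.closedBall x (r.1 : ℝ)))⁻¹ *
    ∫⁻ y in Metric.closedBall x (r.1 : ℝ), g y ∂μ

/-- Centered unweighted maximal function of a measure (rational radii). -/
def Mo (v : Measure (Euc n)) (x : Euc n) : ℝ≥0∞ :=
  ⨆ r : {r : ℚ // 0 < r}, v (Metric.closedBall x (r.1 : ℝ)) * (ENNReal.ofReal ((r.1 : ℝ) ^ n))⁻¹

theorem weak_Mc (n : ℕ) : ∃ N : ℕ, ∀ (μ : Measure (Euc n)) (g : Euc n → ℝ≥0∞) (t : ℝ≥0∞),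
    t * μ {x | t < Mc μ g x} ≤ N * ∫⁻ x, g x ∂μ := by
  obtain ⟨N, τ, hτ, hN⟩ := HasBesicovitchCovering.no_satelliteConfig (α := Euc n)
  refine ⟨N, fun μ g t => ?_⟩
  let S : ℕ → Set (Euc n) := fun k => {x | ∃ r : {r : ℚ // 0 < r}, (r.1 : ℝ) ≤ k ∧
    t < (μ (Metric.closedBall x (r.1 : ℝ)))⁻¹ * ∫⁻ y in Metric.closedBall x (r.1 : ℝ), g y ∂μ}
  have hS : {x | t < Mc μ g x} = ⋃ k, S k := by
    ext x
    simp only [Mc, lt_iSup_iff, mem_ofPred_eq, mem_iUnion, S]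
    constructor
    · rintro ⟨r, hr⟩
      obtain ⟨k, hk⟩ := exists_nat_ge (r.1 : ℝ)
      exact ⟨k, r, hk, hr⟩
    · rintro ⟨k, r, _, hr⟩
      exact ⟨r, hr⟩
  have hmono : Monotone S := by
    intro a b hab x hx
    obtain ⟨r, h1, h2⟩ := hx
    exact ⟨r, h1.trans (by exact_mod_cast hab), h2⟩
  rw [hS, hmono.measure_iUnion, ENNReal.mul_iSup]
  refine iSup_le fun k => ?_
  choose! R hR1 hR2 using fun (x : Euc n) (hx : x ∈ S k) => hx
  let P : Besicovitch.BallPackage (S k) (Euc n) :=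
    { c := fun x => x
      r := fun x => ((R x).1 : ℝ)
      rpos := fun x => by exact_mod_cast (R x).2
      r_bound := k
      r_le := fun x => hR1 x x.2 }
  obtain ⟨s, hs1, hs2⟩ := Besicovitch.exist_disjoint_covering_families hτ hN P
  have hcount : ∀ i, (s i).Countable := by
    intro i
    refine (hs1 i).countable_of_nonempty_interior ?_
    intro x _
    refine ⟨P.c x, ?_⟩
    exact Metric.ball_subset_interior_closedBall (Metric.mem_ball_self (P.rpos x))
  have hball : ∀ x : S k, t * μ (Metric.closedBall (P.c x) (P.r x)) ≤
      ∫⁻ y in Metric.closedBall (P.c x) (P.r x), g y ∂μ := by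
    intro x
    have := hR2 x x.2
    change t < (μ (Metric.closedBall (P.c x) (P.r x)))⁻¹ * _ at this
    calc _ ≤ ((μ (Metric.closedBall (P.c x) (P.r x)))⁻¹ *
        ∫⁻ y in Metric.closedBall (P.c x) (P.r x), g y ∂μ) *
          μ (Metric.closedBall (P.c x) (P.r x)) := by gcongr
      _ = ((μ (Metric.closedBall (P.c x) (P.r x)))⁻¹ * μ (Metric.closedBall (P.c x) (P.r x))) *
        ∫⁻ y in Metric.closedBall (P.c x) (P.r x), g y ∂μ := by ring
      _ ≤ 1 * _ := by gcongr; exact ENNReal.inv_mul_le_one _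
      _ = _ := one_mul _
  have hfam : ∀ i, t * μ (⋃ j ∈ s i, Metric.closedBall (P.c j) (P.r j)) ≤ ∫⁻ x, g x ∂μ := by
    intro i
    calc _ ≤ t * ∑' j : s i, μ (Metric.closedBall (P.c j) (P.r j)) := by
          gcongr; exact measure_biUnion_le μ (hcount i) _
      _ = ∑' j : s i, t * μ (Metric.closedBall (P.c j) (P.r j)) := ENNReal.tsum_mul_left.symm
      _ ≤ ∑' j : s i, ∫⁻ y in Metric.closedBall (P.c j) (P.r j), g y ∂μ :=
          ENNReal.tsum_le_tsum fun j => hball j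
      _ = ∫⁻ y in ⋃ j ∈ s i, Metric.closedBall (P.c j) (P.r j), g y ∂μ := by
          rw [lintegral_biUnion (hcount i) (fun _ _ => Metric.isClosed_closedBall.measurableSet) (hs1 i)]
      _ ≤ _ := setLIntegral_le_lintegral _ _
  have hsub : S k ⊆ ⋃ i, ⋃ j ∈ s i, Metric.closedBall (P.c j) (P.r j) := by
    intro x hx
    have : x ∈ range P.c := ⟨⟨x, hx⟩, rfl⟩
    have := hs2 this
    simp only [mem_iUnion] at this ⊢
    obtain ⟨i, j, hj, h⟩ := this
    exact ⟨i, j, hj, Metric.ball_subset_closedBall h⟩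
  calc t * μ (S k) ≤ t * ∑ i, μ (⋃ j ∈ s i, Metric.closedBall (P.c j) (P.r j)) := by
        gcongr
        exact (measure_mono hsub).trans (measure_iUnion_fintype_le _ _)
    _ = ∑ i, t * μ (⋃ j ∈ s i, Metric.closedBall (P.c j) (P.r j)) := Finset.mul_sum _ _ _
    _ ≤ ∑ i : Fin N, ∫⁻ x, g x ∂μ := Finset.sum_le_sum fun i _ => hfam i
    _ = _ := by simp

theorem measurable_ball_lintegral (μ : Measure (Euc n)) [SFinite μ] (g : Euc n → ℝ≥0∞)
    (hg : Measurable g) (r : ℝ) :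
    Measurable fun x => ∫⁻ y in Metric.closedBall x r, g y ∂μ := by
  have h : ∀ x, ∫⁻ y in Metric.closedBall x r, g y ∂μ =
      ∫⁻ y, {z : Euc n × Euc n | dist z.2 z.1 ≤ r}.indicator (fun z => g z.2) (x, y) ∂μ := by
    intro x
    rw [← lintegral_indicator Metric.isClosed_closedBall.measurableSet]
    rfl
  simp_rw [h]
  refine Measurable.lintegral_prod_right' (f := fun z => {z : Euc n × Euc n | dist z.2 z.1 ≤ r}.indicator (fun z => g z.2) z) ?_
  refine (hg.comp measurable_snd).indicator ?_
  exact (isClosed_le (by fun_prop) (by fun_prop)).measurableSet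

theorem measurable_ball_measure (μ : Measure (Euc n)) [SFinite μ] (r : ℝ) :
    Measurable fun x => μ (Metric.closedBall x r) := by
  have := measurable_ball_lintegral μ (fun _ => 1) measurable_const r
  simpa using this

theorem measurable_Mc (μ : Measure (Euc n)) [SFinite μ] (g : Euc n → ℝ≥0∞)
    (hg : Measurable g) : Measurable (Mc μ g) := by
  unfold Mc
  exact Measurable.iSup fun r => (measurable_ball_measure μ _).inv.mul
    (measurable_ball_lintegral μ g hg _)

theorem measurable_Mo (μ : Measure (Euc n)) [SFinite μ] : Measurable (Mo μ) := by
  unfold Mo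
  exact Measurable.iSup fun r => (measurable_ball_measure μ _).mul_const _

theorem lint_Iio_rpow {β R : ℝ} (hβ : 0 < β) (hR : 0 ≤ R) :
    ∫⁻ t in Ioc 0 R, ENNReal.ofReal (t ^ (β - 1)) = ENNReal.ofReal (R ^ β / β) := by
  have hintg : IntervalIntegrable (fun t : ℝ => t ^ (β - 1)) volume 0 R :=
    intervalIntegral.intervalIntegrable_rpow' (by linarith)
  rw [← ofReal_integral_eq_lintegral_ofReal]
  · rw [← intervalIntegral.integral_of_le hR, integral_rpow (Or.inl (by linarith))]
    simp [Real.zero_rpow hβ.ne']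
  · exact (intervalIntegrable_iff_integrableOn_Ioc_of_le hR).1 hintg
  · filter_upwards [ae_restrict_mem measurableSet_Ioc] with t ht
    exact Real.rpow_nonneg ht.1.le _

theorem lint_Ioi_rpow {γ R : ℝ} (hγ : 0 < γ) (hR : 0 < R) :
    ∫⁻ t in Ioi R, ENNReal.ofReal (t ^ (-γ - 1)) = ENNReal.ofReal (R ^ (-γ) / γ) := by
  rw [← ofReal_integral_eq_lintegral_ofReal]
  · rw [integral_Ioi_rpow_of_lt (by linarith) hR]
    congr 1
    simp [neg_div_neg_eq]
  · exact integrableOn_Ioi_rpow_of_lt (by linarith) hR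
  · filter_upwards [ae_restrict_mem measurableSet_Ioi] with t ht
    exact Real.rpow_nonneg (hR.trans ht).le _

theorem lint_level {β : ℝ} (hβ : 0 < β) (a : ℝ≥0∞) :
    ∫⁻ t in Ioi (0 : ℝ), {t : ℝ | ENNReal.ofReal t < a}.indicator
      (fun t => ENNReal.ofReal (t ^ (β - 1))) t = a ^ β * ENNReal.ofReal (1 / β) := by
  have hmeas : MeasurableSet {t : ℝ | ENNReal.ofReal t < a} :=
    measurableSet_lt ENNReal.measurable_ofReal measurable_const
  rw [setLIntegral_indicator hmeas]
  induction a with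
  | top =>
    simp only [ofReal_lt_top, ofPred_true, univ_inter]
    rw [ENNReal.top_rpow_of_pos hβ, ENNReal.top_mul (by simpa using hβ)]
    refine ENNReal.eq_top_of_forall_nnreal_le ?_
    intro r
    let R : ℝ := (r * β) ^ (1 / β)
    have hR : (0 : ℝ) ≤ R := by positivity
    calc (r : ℝ≥0∞) = ENNReal.ofReal (R ^ β / β) := by
          rw [← Real.rpow_mul (by positivity), one_div, inv_mul_cancel₀ hβ.ne', Real.rpow_one,
            mul_div_cancel_right₀ _ hβ.ne', ENNReal.ofReal_coe_nnreal]
      _ = _ := (lint_Iio_rpow hβ hR).symm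
      _ ≤ _ := lintegral_mono_set Ioc_subset_Ioi_self
  | coe a =>
    have : {t : ℝ | ENNReal.ofReal t < (a : ℝ≥0∞)} ∩ Ioi 0 = Ioo 0 (a : ℝ) := by
      ext t
      simp only [mem_inter_iff, mem_ofPred_eq, mem_Ioi, mem_Ioo]
      rw [and_comm]
      refine and_congr_right fun ht => ?_
      rw [← ENNReal.ofReal_coe_nnreal, ENNReal.ofReal_lt_ofReal_iff_of_nonneg ht.le]
    rw [this, restrict_Ioo_eq_restrict_Ioc, lint_Iio_rpow hβ a.coe_nonneg,
      div_eq_mul_one_div, ENNReal.ofReal_mul (by positivity),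
      ← ENNReal.ofReal_rpow_of_nonneg a.coe_nonneg hβ.le, ENNReal.ofReal_coe_nnreal]



theorem weak_Mc_trunc {N : ℕ} (hN : ∀ (μ : Measure (Euc n)) (g : Euc n → ℝ≥0∞) (t : ℝ≥0∞),
    t * μ {x | t < Mc μ g x} ≤ N * ∫⁻ x, g x ∂μ) (μ : Measure (Euc n)) (g : Euc n → ℝ≥0∞)
    (t : ℝ≥0∞) :
    t * μ {x | t < Mc μ g x} ≤ 2 * N * ∫⁻ x, {x | t < 2 * g x}.indicator g x ∂μ := by
  set g1 := {x | t < 2 * g x}.indicator g with hg1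
  have hpt : ∀ x, g x ≤ g1 x + t / 2 := by
    intro x
    by_cases hx : t < 2 * g x
    · have : g1 x = g x := indicator_of_mem (s := {x | t < 2 * g x}) hx g
      rw [this]; exact le_self_add
    · rw [not_lt] at hx
      refine le_trans ?_ le_add_self
      rw [ENNReal.le_div_iff_mul_le (by simp) (by simp), mul_comm]
      exact hx
  have hM : ∀ x, Mc μ g x ≤ Mc μ g1 x + t / 2 := by
    intro x
    refine iSup_le fun r => ?_
    calc _ ≤ (μ (Metric.closedBall x (r.1 : ℝ)))⁻¹ *
          ∫⁻ y in Metric.closedBall x (r.1 : ℝ), (g1 y + t / 2) ∂μ := by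
            gcongr with y; exact hpt y
      _ = (μ (Metric.closedBall x (r.1 : ℝ)))⁻¹ *
          ∫⁻ y in Metric.closedBall x (r.1 : ℝ), g1 y ∂μ +
            (t / 2) * ((μ (Metric.closedBall x (r.1 : ℝ)))⁻¹ *
              (μ (Metric.closedBall x (r.1 : ℝ)))) := by
            rw [lintegral_add_right _ measurable_const, setLIntegral_const, mul_add]
            ring
      _ ≤ Mc μ g1 x + (t / 2) * 1 := by
            gcongr
            · exact le_iSup (fun r : {r : ℚ // 0 < r} => (μ (Metric.closedBall x (r.1 : ℝ)))⁻¹ *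
                ∫⁻ y in Metric.closedBall x (r.1 : ℝ), g1 y ∂μ) r
            · exact ENNReal.inv_mul_le_one _
      _ = _ := by rw [mul_one]
  have hsub : {x | t < Mc μ g x} ⊆ {x | t / 2 < Mc μ g1 x} := by
    intro x hx
    simp only [mem_ofPred_eq] at hx ⊢
    by_contra h
    rw [not_lt] at h
    have := (hM x).trans (add_le_add_left h _)
    rw [ENNReal.add_halves] at this
    exact absurd hx (not_lt.2 this)
  calc t * μ {x | t < Mc μ g x} ≤ t * μ {x | t / 2 < Mc μ g1 x} := by gcongr
    _ = 2 * ((t / 2) * μ {x | t / 2 < Mc μ g1 x}) := by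
        rw [← mul_assoc, ENNReal.mul_div_cancel (by simp) (by simp)]
    _ ≤ 2 * (N * ∫⁻ x, g1 x ∂μ) := mul_le_mul_right (hN μ g1 _) _
    _ = _ := by ring

theorem strong_Mc (n : ℕ) (s : ℝ) (hs : 1 < s) : ∃ C : ℝ≥0∞, C ≠ ⊤ ∧
    ∀ (μ : Measure (Euc n)) [SFinite μ] (g : Euc n → ℝ≥0∞), Measurable g →
    ∫⁻ x, Mc μ g x ^ s ∂μ ≤ C * ∫⁻ x, g x ^ s ∂μ := by
  obtain ⟨N, hN⟩ := weak_Mc n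
  have hs0 : 0 < s := by linarith
  have hs1 : 0 < s - 1 := by linarith
  refine ⟨ENNReal.ofReal s * (2 * N * (2 ^ (s - 1) * ENNReal.ofReal (1 / (s - 1)))), ?_, ?_⟩
  · have : (2 : ℝ≥0∞) ^ (s - 1) ≠ ⊤ := ENNReal.rpow_ne_top_of_nonneg hs1.le (by simp)
    finiteness
  intro μ _ g hg
  have hMm := measurable_Mc μ g hg
  have key : ENNReal.ofReal (1 / s) * ∫⁻ x, Mc μ g x ^ s ∂μ ≤
      2 * N * (2 ^ (s - 1) * ENNReal.ofReal (1 / (s - 1))) * ∫⁻ x, g x ^ s ∂μ := by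
    calc ENNReal.ofReal (1 / s) * ∫⁻ x, Mc μ g x ^ s ∂μ
        = ∫⁻ x, Mc μ g x ^ s * ENNReal.ofReal (1 / s) ∂μ := by
          rw [lintegral_mul_const _ (hMm.pow_const s), mul_comm]
      _ = ∫⁻ x, (∫⁻ t in Ioi (0 : ℝ), {t : ℝ | ENNReal.ofReal t < Mc μ g x}.indicator
            (fun t => ENNReal.ofReal (t ^ (s - 1))) t) ∂μ := by
          simp_rw [lint_level hs0]
      _ = ∫⁻ t in Ioi (0 : ℝ), ∫⁻ x, {t : ℝ | ENNReal.ofReal t < Mc μ g x}.indicator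
            (fun t => ENNReal.ofReal (t ^ (s - 1))) t ∂μ := by
          refine lintegral_lintegral_swap ?_
          have : Measurable ({z : Euc n × ℝ | ENNReal.ofReal z.2 < Mc μ g z.1}.indicator
            (fun z => ENNReal.ofReal (z.2 ^ (s - 1)))) := by
            refine Measurable.indicator (by fun_prop) ?_
            exact measurableSet_lt (by fun_prop) (by fun_prop)
          exact this.aemeasurable
      _ = ∫⁻ t in Ioi (0 : ℝ), ENNReal.ofReal (t ^ (s - 1)) *
            μ {x | ENNReal.ofReal t < Mc μ g x} := by
          refine lintegral_congr fun t => ?_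
          have hms : MeasurableSet {x | ENNReal.ofReal t < Mc μ g x} :=
            measurableSet_lt measurable_const hMm
          rw [← setLIntegral_const, ← lintegral_indicator hms]
          rfl
      _ ≤ ∫⁻ t in Ioi (0 : ℝ), 2 * N * ∫⁻ x, {t : ℝ | ENNReal.ofReal t < 2 * g x}.indicator
            (fun t => ENNReal.ofReal (t ^ (s - 1 - 1))) t * g x ∂μ := by
          refine setLIntegral_mono' measurableSet_Ioi fun t ht => ?_
          have ht : 0 < t := ht
          have e1 : ENNReal.ofReal (t ^ (s - 1)) =
              ENNReal.ofReal (t ^ (s - 1 - 1)) * ENNReal.ofReal t := by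
            rw [← ENNReal.ofReal_mul (by positivity)]
            congr 1
            rw [← Real.rpow_add_one ht.ne']
            congr 1; ring
          calc _ = ENNReal.ofReal (t ^ (s - 1 - 1)) *
                (ENNReal.ofReal t * μ {x | ENNReal.ofReal t < Mc μ g x}) := by rw [e1]; ring
            _ ≤ ENNReal.ofReal (t ^ (s - 1 - 1)) * (2 * N *
                ∫⁻ x, {x | ENNReal.ofReal t < 2 * g x}.indicator g x ∂μ) := mul_le_mul_right (weak_Mc_trunc hN μ g _) _
            _ = 2 * N * ∫⁻ x, ENNReal.ofReal (t ^ (s - 1 - 1)) *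
                  {x | ENNReal.ofReal t < 2 * g x}.indicator g x ∂μ := by
                rw [lintegral_const_mul]
                · ring
                · exact hg.indicator (measurableSet_lt measurable_const (by fun_prop))
            _ = _ := by
                congr 1
                refine lintegral_congr fun x => ?_
                by_cases hx : ENNReal.ofReal t < 2 * g x
                · simp [indicator, hx]
                · simp [indicator, hx]
      _ = 2 * N * ∫⁻ t in Ioi (0 : ℝ), ∫⁻ x, {t : ℝ | ENNReal.ofReal t < 2 * g x}.indicator
            (fun t => ENNReal.ofReal (t ^ (s - 1 - 1))) t * g x ∂μ := by
          rw [lintegral_const_mul' _ _ (by finiteness)]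
      _ = 2 * N * ∫⁻ x, (∫⁻ t in Ioi (0 : ℝ), {t : ℝ | ENNReal.ofReal t < 2 * g x}.indicator
            (fun t => ENNReal.ofReal (t ^ (s - 1 - 1))) t * g x) ∂μ := by
          congr 1
          refine (lintegral_lintegral_swap ?_).symm
          have : Measurable (fun z : Euc n × ℝ =>
            ({z : Euc n × ℝ | ENNReal.ofReal z.2 < 2 * g z.1}.indicator
            (fun z => ENNReal.ofReal (z.2 ^ (s - 1 - 1)))) z * g z.1) := by
            refine Measurable.mul (Measurable.indicator (by fun_prop) ?_) (by fun_prop)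
            exact measurableSet_lt (by fun_prop) (by fun_prop)
          exact this.aemeasurable
      _ = 2 * N * ∫⁻ x, (2 ^ (s - 1) * ENNReal.ofReal (1 / (s - 1))) * g x ^ s ∂μ := by
          congr 1
          refine lintegral_congr fun x => ?_
          rw [lintegral_mul_const, lint_level hs1, ENNReal.mul_rpow_of_nonneg _ _ hs1.le]
          · have : g x ^ s = g x ^ (s - 1) * g x := by
              conv_rhs => rw [← ENNReal.rpow_one (g x), ← ENNReal.rpow_mul]
              rw [one_mul, ← ENNReal.rpow_add_of_nonneg _ _ hs1.le zero_le_one]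
              congr 1; ring
            rw [this]; ring
          · refine Measurable.indicator (by fun_prop) ?_
            exact measurableSet_lt (by fun_prop) (by fun_prop)
      _ = _ := by
          rw [lintegral_const_mul _ (hg.pow_const s)]; ring
  calc ∫⁻ x, Mc μ g x ^ s ∂μ
      = ENNReal.ofReal s * (ENNReal.ofReal (1 / s) * ∫⁻ x, Mc μ g x ^ s ∂μ) := by
        rw [← mul_assoc, ← ENNReal.ofReal_mul hs0.le, mul_one_div_cancel hs0.ne']; simp
    _ ≤ _ := by
        rw [mul_assoc]; gcongr

theorem ball_le_Mo (v : Measure (Euc n)) (y : Euc n) {r : ℝ} (hr : 0 < r) :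
    v (Metric.closedBall y r) ≤ ENNReal.ofReal (2 ^ n * r ^ n) * Mo v y := by
  obtain ⟨r', h1, h2⟩ := exists_rat_btwn (show r < 2 * r by linarith)
  have hr' : (0 : ℝ) < r' := hr.trans h1
  have hpos : (0 : ℝ) < (r' : ℝ) ^ n := by positivity
  calc v (Metric.closedBall y r) ≤ v (Metric.closedBall y r') :=
        measure_mono (Metric.closedBall_subset_closedBall h1.le)
    _ = ENNReal.ofReal ((r' : ℝ) ^ n) *
        (v (Metric.closedBall y r') * (ENNReal.ofReal ((r' : ℝ) ^ n))⁻¹) := by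
        rw [mul_comm (v _), ← mul_assoc, ENNReal.mul_inv_cancel, one_mul]
        · simpa using hpos
        · simp
    _ ≤ _ := by
        rw [← mul_pow]
        gcongr
        exact le_iSup (fun r : {r : ℚ // 0 < r} => v (Metric.closedBall y (r.1 : ℝ)) *
          (ENNReal.ofReal ((r.1 : ℝ) ^ n))⁻¹) ⟨r', by exact_mod_cast hr'⟩

theorem hedberg_R {α : ℝ} (hα : 0 < α) (hαn : α < n) (v : Measure (Euc n)) [SFinite v]
    (y : Euc n) {R : ℝ} (hR : 0 < R) :
    ∫⁻ x, ENNReal.ofReal (‖x - y‖ ^ (α - n)) ∂v ≤ ENNReal.ofReal (n - α) *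
      (ENNReal.ofReal (2 ^ n) * Mo v y * ENNReal.ofReal (R ^ α / α) +
        v univ * ENNReal.ofReal (R ^ (-(n - α)) / (n - α))) := by
  have hγ : 0 < n - α := by linarith
  calc ∫⁻ x, ENNReal.ofReal (‖x - y‖ ^ (α - n)) ∂v
      ≤ ∫⁻ x, ENNReal.ofReal (n - α) * (∫⁻ r in Ioi (0 : ℝ), {r : ℝ | ‖x - y‖ < r}.indicator
          (fun r => ENNReal.ofReal (r ^ (-(n - α) - 1))) r) ∂v := by
        refine lintegral_mono fun x => ?_
        rw [setLIntegral_indicator (show MeasurableSet {r : ℝ | ‖x - y‖ < r} from measurableSet_Ioi)]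
        rcases (norm_nonneg (x - y)).eq_or_lt with h | h
        · rw [← h, Real.zero_rpow (by linarith)]; simp
        · have : {r : ℝ | ‖x - y‖ < r} ∩ Ioi 0 = Ioi ‖x - y‖ := by
            ext r
            simp only [mem_inter_iff, mem_ofPred_eq, mem_Ioi]
            exact ⟨fun h => h.1, fun h' => ⟨h', h.trans h'⟩⟩
          rw [this, lint_Ioi_rpow hγ h, ← ENNReal.ofReal_mul hγ.le, mul_div_cancel₀ _ hγ.ne', neg_sub]
    _ = ENNReal.ofReal (n - α) * ∫⁻ x, (∫⁻ r in Ioi (0 : ℝ), {r : ℝ | ‖x - y‖ < r}.indicator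
          (fun r => ENNReal.ofReal (r ^ (-(n - α) - 1))) r) ∂v := by
        rw [lintegral_const_mul' _ _ (by finiteness)]
    _ = ENNReal.ofReal (n - α) * ∫⁻ r in Ioi (0 : ℝ), ∫⁻ x, {r : ℝ | ‖x - y‖ < r}.indicator
          (fun r => ENNReal.ofReal (r ^ (-(n - α) - 1))) r ∂v := by
        congr 1
        refine lintegral_lintegral_swap ?_
        have : Measurable ({z : Euc n × ℝ | ‖z.1 - y‖ < z.2}.indicator
            (fun z => ENNReal.ofReal (z.2 ^ (-(n - α) - 1)))) := by
          refine Measurable.indicator (by fun_prop) ?_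
          exact measurableSet_lt (by fun_prop) (by fun_prop)
        exact this.aemeasurable
    _ = ENNReal.ofReal (n - α) * ∫⁻ r in Ioi (0 : ℝ), ENNReal.ofReal (r ^ (-(n - α) - 1)) *
          v (Metric.ball y r) := by
        congr 1
        refine lintegral_congr fun r => ?_
        rw [← setLIntegral_const, ← lintegral_indicator Metric.isOpen_ball.measurableSet]
        refine lintegral_congr fun x => ?_
        simp only [indicator, mem_ofPred_eq, Metric.mem_ball, dist_eq_norm]
    _ ≤ ENNReal.ofReal (n - α) * (
          (∫⁻ r in Ioc (0 : ℝ) R, ENNReal.ofReal (r ^ (-(n - α) - 1)) * v (Metric.ball y r)) +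
          ∫⁻ r in Ioi R, ENNReal.ofReal (r ^ (-(n - α) - 1)) * v (Metric.ball y r)) := by
        gcongr
        rw [← Ioc_union_Ioi_eq_Ioi hR.le]
        exact lintegral_union_le _ _ _
    _ ≤ _ := by
        gcongr
        · rw [← lint_Iio_rpow hα hR.le, ← lintegral_const_mul _ (by fun_prop)]
          refine setLIntegral_mono' measurableSet_Ioc fun r hr => ?_
          have hr0 := hr.1
          calc _ ≤ ENNReal.ofReal (r ^ (-(n - α) - 1)) * (ENNReal.ofReal (2 ^ n * r ^ n) * Mo v y) := by
                gcongr
                exact (measure_mono Metric.ball_subset_closedBall).trans (ball_le_Mo v y hr0)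
            _ = _ := by
                have : r ^ (α - 1) = r ^ (-(n - α) - 1) * r ^ n := by
                  rw [← Real.rpow_add_natCast hr0.ne']; congr 1; ring
                rw [this, ENNReal.ofReal_mul (by positivity), ENNReal.ofReal_mul (by positivity)]
                ring
        · rw [← lint_Ioi_rpow hγ hR, ← lintegral_const_mul _ (by fun_prop)]
          refine setLIntegral_mono' measurableSet_Ioi fun r hr => ?_
          rw [mul_comm]
          gcongr
          exact subset_univ _

theorem hedberg (hn : 0 < n) {α : ℝ} (hα : 0 < α) (hαn : α < n) (v : Measure (Euc n)) [SFinite v]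
    (hv0 : v univ ≠ 0) (hv1 : v univ ≠ ⊤) (y : Euc n) :
    ∫⁻ x, ENNReal.ofReal (‖x - y‖ ^ (α - n)) ∂v ≤ ENNReal.ofReal ((n - α) * 2 ^ n / α + 1) *
      Mo v y ^ (1 - α / n) * v univ ^ (α / n) := by
  have hn' : (0 : ℝ) < n := by exact_mod_cast hn
  have hγ : 0 < n - α := by linarith
  have h1 : 0 < 1 - α / n := by rw [sub_pos, div_lt_one hn']; exact hαn
  have hM0 : Mo v y ≠ 0 := by
    intro h
    apply hv0
    rw [← Metric.iUnion_closedBall_nat y, measure_iUnion_null_iff]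
    intro k
    have h2 := ball_le_Mo v y (show (0 : ℝ) < k + 1 by positivity)
    rw [h, mul_zero] at h2
    refine le_antisymm (le_trans (measure_mono ?_) h2) zero_le
    exact Metric.closedBall_subset_closedBall (by linarith)
  by_cases hMt : Mo v y = ⊤
  · rw [hMt, ENNReal.top_rpow_of_pos h1, ENNReal.mul_top, ENNReal.top_mul]
    · exact le_top
    · simp [ENNReal.rpow_eq_zero_iff, hv0, hv1]
    · have : 0 < (n - α) * 2 ^ n / α + 1 := by positivity
      simpa using this
  have hV : 0 < (v univ).toReal := ENNReal.toReal_pos hv0 hv1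
  have hM : 0 < (Mo v y).toReal := ENNReal.toReal_pos hM0 hMt
  set V := (v univ).toReal with hVd
  set M := (Mo v y).toReal with hMd
  have eV : v univ = ENNReal.ofReal V := (ENNReal.ofReal_toReal hv1).symm
  have eM : Mo v y = ENNReal.ofReal M := (ENNReal.ofReal_toReal hMt).symm
  have hR : 0 < (V / M) ^ (1 / n : ℝ) := by positivity
  refine (hedberg_R hα hαn v y hR).trans ?_
  rw [eV, eM, ENNReal.ofReal_rpow_of_pos hM, ENNReal.ofReal_rpow_of_pos hV,
    ← ENNReal.ofReal_mul (by positivity), ← ENNReal.ofReal_mul (by positivity),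
    ← ENNReal.ofReal_mul (by positivity), ← ENNReal.ofReal_add (by positivity) (by positivity),
    ← ENNReal.ofReal_mul (by positivity), ← ENNReal.ofReal_mul (by positivity),
    ← ENNReal.ofReal_mul (by positivity)]
  apply ENNReal.ofReal_le_ofReal
  apply le_of_eq
  have e1 : ((V / M) ^ (1 / n : ℝ)) ^ α = V ^ (α / n) / M ^ (α / n) := by
    rw [← Real.rpow_mul (by positivity), ← Real.div_rpow hV.le hM.le]; congr 1; field_simp
  have e2 : ((V / M) ^ (1 / n : ℝ)) ^ (-(n - α)) = V ^ (α / n) / M ^ (α / n) * (M / V) := by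
    rw [← Real.rpow_mul (by positivity), ← Real.div_rpow hV.le hM.le]
    have : M / V = (V / M) ^ (-1 : ℝ) := by rw [Real.rpow_neg_one, inv_div]
    rw [this, ← Real.rpow_add (by positivity)]; congr 1; field_simp; ring
  have e3 : M ^ (1 - α / n) = M / M ^ (α / n) := by
    rw [Real.rpow_sub hM, Real.rpow_one]
  rw [e1, e2, e3]
  have : M ^ (α / n) ≠ 0 := by positivity
  field_simp



theorem cube_eq (a : Euc n) (h : ℝ) : Cube a h =
    (@WithLp.ofLp 2 (Fin n → ℝ)) ⁻¹' (Icc (WithLp.ofLp a) (fun i => a i + h)) := by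
  ext x
  simp only [Cube, mem_ofPred_eq, mem_preimage, mem_Icc, Pi.le_def]
  exact ⟨fun H => ⟨fun i => (H i).1, fun i => (H i).2⟩, fun H i => ⟨H.1 i, H.2 i⟩⟩

theorem cube_meas (a : Euc n) (h : ℝ) : MeasurableSet (Cube a h) := by
  rw [cube_eq]
  exact (PiLp.volume_preserving_ofLp (Fin n)).measurable measurableSet_Icc

theorem cube_volume (a : Euc n) {h : ℝ} (hh : 0 ≤ h) :
    volume (Cube a h) = ENNReal.ofReal (h ^ n) := by
  rw [cube_eq, (PiLp.volume_preserving_ofLp (Fin n)).measure_preimage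
    measurableSet_Icc.nullMeasurableSet, Real.volume_Icc_pi]
  simp [ENNReal.ofReal_pow hh]

theorem ball_subset_cube (y : Euc n) (r : ℝ) :
    Metric.closedBall y r ⊆ Cube (WithLp.toLp 2 fun i => y i - r) (2 * r) := by
  intro x hx i
  have h1 : ‖(x - y) i‖ ≤ ‖x - y‖ := PiLp.norm_apply_le _ i
  rw [Metric.mem_closedBall, dist_eq_norm] at hx
  have h2 := h1.trans hx
  rw [Real.norm_eq_abs, abs_le] at h2
  simp only [PiLp.sub_apply] at h2
  constructor
  · change y i - r ≤ x i
    linarith [h2.1]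
  · change x i ≤ y i - r + 2 * r
    linarith [h2.2]

theorem ball_avg_le (g : Euc n → ℝ≥0∞) (y : Euc n) {r : ℝ} (hr : 0 < r) :
    (ENNReal.ofReal (r ^ n))⁻¹ * ∫⁻ x in Metric.closedBall y r, g x ≤
      2 ^ n * ((volume (Cube (WithLp.toLp 2 fun i => y i - r) (2 * r)))⁻¹ *
        ∫⁻ x in Cube (WithLp.toLp 2 fun i => y i - r) (2 * r), g x) := by
  rw [cube_volume _ (by positivity), ← mul_assoc]
  gcongr
  · rw [mul_pow, ENNReal.ofReal_mul (by positivity), ENNReal.mul_inv (Or.inr (by simp)) (Or.inl (by simp)),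
      ← mul_assoc]
    have : ENNReal.ofReal (2 ^ n) = 2 ^ n := by
      rw [ENNReal.ofReal_pow (by norm_num)]; simp
    rw [this, ENNReal.mul_inv_cancel (by simp) (by finiteness), one_mul]
  · exact ball_subset_cube y r

theorem Apq_ball {p q : ℝ} (hp : p ≠ 1) (hτ : 0 ≤ q / dualExp p) (w : Euc n → ℝ) (y : Euc n) {r : ℝ}
    (hr : 0 < r) :
    ((ENNReal.ofReal (r ^ n))⁻¹ * ∫⁻ x in Metric.closedBall y r, ENNReal.ofReal (w x) ^ q) *
     ((ENNReal.ofReal (r ^ n))⁻¹ * ∫⁻ x in Metric.closedBall y r,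
        ENNReal.ofReal (w x) ^ (-(dualExp p))) ^ (q / dualExp p) ≤
      (2 ^ n * (2 ^ n) ^ (q / dualExp p)) * Apq p q w := by
  have h : ((volume (Cube (WithLp.toLp 2 fun i => y i - r) (2 * r)))⁻¹ *
      ∫⁻ x in Cube (WithLp.toLp 2 fun i => y i - r) (2 * r), ENNReal.ofReal (w x) ^ q) *
      ((volume (Cube (WithLp.toLp 2 fun i => y i - r) (2 * r)))⁻¹ *
      ∫⁻ x in Cube (WithLp.toLp 2 fun i => y i - r) (2 * r), ENNReal.ofReal (w x) ^ (-(dualExp p)))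
        ^ (q / dualExp p) ≤ Apq p q w := by
    unfold Apq
    simp only [if_neg hp]
    exact le_iSup_of_le _ (le_iSup_of_le (2 * r) (le_iSup_of_le (by positivity) le_rfl))
  refine (mul_le_mul' (ball_avg_le _ y hr)
    (ENNReal.rpow_le_rpow (ball_avg_le _ y hr) hτ)).trans ?_
  rw [ENNReal.mul_rpow_of_nonneg _ _ hτ]
  refine le_trans (le_of_eq ?_) (mul_le_mul_right h _)
  ring

theorem lerner_r {q P s : ℝ} (hq : 0 < q) (hP : 0 < P) (hs : s = 1 + P / q)
    (W : Euc n → ℝ≥0∞) (hW : Measurable W) (hW0 : ∀ᵐ x, W x ≠ 0) (hWt : ∀ x, W x ≠ ⊤)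
    (K : ℝ≥0∞) (hK : K ≠ ⊤)
    (HB : ∀ (y : Euc n) (r : ℝ), 0 < r →
      ((ENNReal.ofReal (r ^ n))⁻¹ * ∫⁻ x in Metric.closedBall y r, W x ^ q) *
      ((ENNReal.ofReal (r ^ n))⁻¹ * ∫⁻ x in Metric.closedBall y r, W x ^ (-P)) ^ (q / P) ≤ K)
    (E : Set (Euc n)) (hE : MeasurableSet E) (y : Euc n) (r : {r : ℚ // 0 < r}) :
    ((volume.withDensity fun x => W x ^ q).restrict E (Metric.closedBall y (r.1 : ℝ)) *
      (ENNReal.ofReal ((r.1 : ℝ) ^ n))⁻¹) ^ (s - 1) ≤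
      (3 ^ n) ^ (s - 1) * 3 ^ n * (volume (Metric.ball (0 : Euc n) 1))⁻¹ * K ^ (s - 1) *
      Mc (volume.withDensity fun x => W x ^ (-P)) (fun x =>
        Mc (volume.withDensity fun x => W x ^ q) (E.indicator 1) x ^ (s - 1) * W x ^ P) y := by
  have hr : (0 : ℝ) < r.1 := by exact_mod_cast r.2
  have h3r : (0 : ℝ) < 3 * r.1 := by positivity
  have hs1 : 0 < s - 1 := by rw [hs]; simp; positivity
  have hsτ : q / P * (s - 1) = 1 := by rw [hs]; field_simp; ring
  set μu := volume.withDensity fun x => W x ^ q with hμu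
  set μσ := volume.withDensity fun x => W x ^ (-P) with hμσ
  set B := Metric.closedBall y (r.1 : ℝ) with hBdef
  set B3 := Metric.closedBall y (3 * r.1 : ℝ) with hB3def
  have hBm : MeasurableSet B := Metric.isClosed_closedBall.measurableSet
  have hB3m : MeasurableSet B3 := Metric.isClosed_closedBall.measurableSet
  have hBB3 : B ⊆ B3 := Metric.closedBall_subset_closedBall (by linarith)
  set X := μu.restrict E B with hX
  set U := ∫⁻ x in B3, W x ^ q with hU
  set S := ∫⁻ x in B3, W x ^ (-P) with hS
  set ρ := ENNReal.ofReal ((r.1 : ℝ) ^ n) with hρ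
  set ρ3 := ENNReal.ofReal ((3 * r.1 : ℝ) ^ n) with hρ3
  have hUμ : μu B3 = U := withDensity_apply _ hB3m
  have hSμ : μσ B3 = S := withDensity_apply _ hB3m
  have eρ : ρ3 = 3 ^ n * ρ := by
    rw [hρ3, mul_pow, ENNReal.ofReal_mul (by positivity), ENNReal.ofReal_pow (by norm_num)]
    simp [hρ]
  have hρ0 : ρ ≠ 0 := by
    have : (0 : ℝ) < (r.1 : ℝ) ^ n := by positivity
    simpa [hρ] using this
  have hρt : ρ ≠ ⊤ := by simp [hρ]
  have hρthree_zero : ρ3 ≠ 0 := by rw [eρ]; simp [hρ0]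
  have hρthree_top : ρ3 ≠ ⊤ := by simp [hρ3]
  have hHB := HB y (3 * r.1) h3r
  change (ρ3⁻¹ * U) * (ρ3⁻¹ * S) ^ (q / P) ≤ K at hHB
  have hvol3 : volume B3 ≠ 0 := (Metric.measure_closedBall_pos volume y h3r).ne'
  have hU0 : U ≠ 0 := by
    intro h
    rw [hU, setLIntegral_eq_zero_iff hB3m (hW.pow_const q)] at h
    apply hvol3
    rw [measure_eq_zero_iff_ae_notMem]
    filter_upwards [h, hW0] with x h1 h2 h3
    have := h1 h3
    rw [ENNReal.rpow_eq_zero_iff_of_pos hq] at this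
    exact h2 this
  have hS0 : S ≠ 0 := by
    intro h
    rw [hS, setLIntegral_eq_zero_iff hB3m (hW.pow_const _)] at h
    apply hvol3
    rw [measure_eq_zero_iff_ae_notMem]
    filter_upwards [h, hW0] with x h1 h2 h3
    have := h1 h3
    rw [ENNReal.rpow_eq_zero_iff] at this
    rcases this with h | h
    · exact h2 h.1
    · exact hWt x h.1
  have hUt : U ≠ ⊤ := by
    intro h
    rw [h, ENNReal.mul_top (by simpa using hρthree_top), ENNReal.top_mul] at hHB
    · exact hK (top_le_iff.1 hHB)
    · rw [Ne, ENNReal.rpow_eq_zero_iff_of_pos (by positivity), mul_eq_zero]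
      simp [hρthree_top, hS0]
  have hSt : S ≠ ⊤ := by
    intro h
    rw [h, ENNReal.mul_top (by simpa using hρthree_top), ENNReal.top_rpow_of_pos (by positivity),
      ENNReal.mul_top] at hHB
    · exact hK (top_le_iff.1 hHB)
    · simp [hρthree_top, hU0]
  set m := Mc μu (E.indicator 1) with hm
  set h := fun x => m x ^ (s - 1) * W x ^ P with hh
  have hmm : Measurable m := measurable_Mc _ _ (measurable_one.indicator hE)
  have ha : ∀ x ∈ B, U⁻¹ * X ≤ m x := by
    intro x hx
    have hxy : dist x y ≤ r.1 := hx
    have s1 : B ⊆ Metric.closedBall x (((2 * r.1 : ℚ)) : ℝ) := by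
      intro z hz
      have hz : dist z y ≤ r.1 := hz
      rw [Metric.mem_closedBall]; push_cast
      linarith [dist_triangle_right z x y]
    have s2 : Metric.closedBall x (((2 * r.1 : ℚ)) : ℝ) ⊆ B3 := by
      apply Metric.closedBall_subset_closedBall'
      push_cast; linarith
    refine le_trans ?_ (le_iSup (fun r : {r : ℚ // 0 < r} =>
      (μu (Metric.closedBall x (r.1 : ℝ)))⁻¹ *
      ∫⁻ y in Metric.closedBall x (r.1 : ℝ), (E.indicator 1 : Euc n → ℝ≥0∞) y ∂μu)
      ⟨2 * r.1, by have := r.2; positivity⟩)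
    rw [← hUμ]
    gcongr
    rw [lintegral_indicator_one hE, Measure.restrict_apply hE, hX, Measure.restrict_apply hBm,
      inter_comm]
    gcongr
  have hκ : volume B = ρ * volume (Metric.ball (0 : Euc n) 1) := by
    have := Measure.addHaar_closedBall (volume : Measure (Euc n)) y hr.le
    rw [finrank_euclideanSpace_fin] at this
    exact this
  have hκ0 : volume (Metric.ball (0 : Euc n) 1) ≠ 0 :=
    (Metric.measure_ball_pos volume _ one_pos).ne'
  have hκt : volume (Metric.ball (0 : Euc n) 1) ≠ ⊤ := measure_ball_lt_top.ne
  set κ := volume (Metric.ball (0 : Euc n) 1) with hκdef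
  have hhm : Measurable h := (hmm.pow_const _).mul (hW.pow_const _)
  have hb : (U⁻¹ * X) ^ (s - 1) * (ρ * κ) ≤ S * Mc μσ h y := by
    calc (U⁻¹ * X) ^ (s - 1) * (ρ * κ) = ∫⁻ x in B, (U⁻¹ * X) ^ (s - 1) := by
          rw [setLIntegral_const, hκ]
      _ ≤ ∫⁻ x in B, m x ^ (s - 1) :=
          setLIntegral_mono' hBm fun x hx => ENNReal.rpow_le_rpow (ha x hx) hs1.le
      _ = ∫⁻ x in B, W x ^ (-P) * h x := by
          refine setLIntegral_congr_fun_ae hBm ?_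
          filter_upwards [hW0] with x hx _
          have : W x ^ (-P) * W x ^ P = 1 := by
            rw [← ENNReal.rpow_add _ _ hx (hWt x)]; simp
          rw [hh]
          calc m x ^ (s - 1) = m x ^ (s - 1) * (W x ^ (-P) * W x ^ P) := by rw [this, mul_one]
            _ = _ := by ring
      _ ≤ ∫⁻ x in B3, W x ^ (-P) * h x := lintegral_mono_set hBB3
      _ = ∫⁻ x in B3, h x ∂μσ := by
          rw [hμσ, setLIntegral_withDensity_eq_setLIntegral_mul _ (hW.pow_const _) hhm hB3m]
          rfl
      _ = S * (S⁻¹ * ∫⁻ x in B3, h x ∂μσ) := by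
          rw [← mul_assoc, ENNReal.mul_inv_cancel hS0 hSt, one_mul]
      _ ≤ _ := by
          gcongr
          rw [← hSμ]
          have := le_iSup (fun r : {r : ℚ // 0 < r} =>
            (μσ (Metric.closedBall y (r.1 : ℝ)))⁻¹ *
            ∫⁻ z in Metric.closedBall y (r.1 : ℝ), h z ∂μσ) ⟨3 * r.1, by have := r.2; positivity⟩
          push_cast at this
          exact this
  have hc : (ρ3⁻¹ * U) ^ (s - 1) * (ρ3⁻¹ * S) ≤ K ^ (s - 1) := by
    have := ENNReal.rpow_le_rpow hHB hs1.le
    rwa [ENNReal.mul_rpow_of_nonneg _ _ hs1.le, ← ENNReal.rpow_mul, hsτ, ENNReal.rpow_one] at this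
  have hXe : X * ρ⁻¹ = 3 ^ n * ((ρ3⁻¹ * U) * (U⁻¹ * X)) := by
    rw [eρ, ENNReal.mul_inv (Or.inr hρt) (Or.inr hρ0)]
    calc X * ρ⁻¹ = (3 ^ n * (3 ^ n)⁻¹) * (U * U⁻¹) * (X * ρ⁻¹) := by
          rw [ENNReal.mul_inv_cancel (by simp) (by finiteness), ENNReal.mul_inv_cancel hU0 hUt]; simp
      _ = _ := by ring
  have hb' : (U⁻¹ * X) ^ (s - 1) ≤ 3 ^ n * κ⁻¹ * (ρ3⁻¹ * S) * Mc μσ h y := by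
    calc (U⁻¹ * X) ^ (s - 1) = (U⁻¹ * X) ^ (s - 1) * (ρ * κ) * (ρ⁻¹ * κ⁻¹) := by
          calc _ = (U⁻¹ * X) ^ (s - 1) * (ρ * ρ⁻¹) * (κ * κ⁻¹) := by
                rw [ENNReal.mul_inv_cancel hρ0 hρt, ENNReal.mul_inv_cancel hκ0 hκt]; simp
            _ = _ := by ring
      _ ≤ S * Mc μσ h y * (ρ⁻¹ * κ⁻¹) := by gcongr
      _ = (3 ^ n * (3 ^ n)⁻¹) * (S * Mc μσ h y * (ρ⁻¹ * κ⁻¹)) := by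
          rw [ENNReal.mul_inv_cancel (by simp) (by finiteness), one_mul]
      _ = _ := by
          rw [eρ, ENNReal.mul_inv (Or.inr hρt) (Or.inr hρ0)]; ring
  rw [hXe, ENNReal.mul_rpow_of_nonneg _ _ hs1.le, ENNReal.mul_rpow_of_nonneg _ _ hs1.le]
  calc _ ≤ (3 ^ n) ^ (s - 1) * ((ρ3⁻¹ * U) ^ (s - 1) *
        (3 ^ n * κ⁻¹ * (ρ3⁻¹ * S) * Mc μσ h y)) := by gcongr
    _ = (3 ^ n) ^ (s - 1) * 3 ^ n * κ⁻¹ * ((ρ3⁻¹ * U) ^ (s - 1) * (ρ3⁻¹ * S)) * Mc μσ h y := by ring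
    _ ≤ _ := by gcongr



theorem buckley (n : ℕ) {q P s : ℝ} (hq : 0 < q) (hP : 0 < P) (hs : s = 1 + P / q) :
    ∃ C : ℝ≥0∞, C ≠ ⊤ ∧ ∀
    (W : Euc n → ℝ≥0∞) (_ : Measurable W) (_ : ∀ᵐ x, W x ≠ 0) (_ : ∀ x, W x ≠ ⊤)
    (K : ℝ≥0∞) (_ : K ≠ ⊤)
    (_ : ∀ (y : Euc n) (r : ℝ), 0 < r →
      ((ENNReal.ofReal (r ^ n))⁻¹ * ∫⁻ x in Metric.closedBall y r, W x ^ q) *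
      ((ENNReal.ofReal (r ^ n))⁻¹ * ∫⁻ x in Metric.closedBall y r, W x ^ (-P)) ^ (q / P) ≤ K)
    (E : Set (Euc n)) (_ : MeasurableSet E),
    ∫⁻ y, W y ^ (-P) * Mo ((volume.withDensity fun x => W x ^ q).restrict E) y ^ s ≤
      C * K ^ s * (volume.withDensity fun x => W x ^ q) E := by
  have hs1 : 0 < s - 1 := by rw [hs]; simp; positivity
  have hs' : 1 < s / (s - 1) := by rw [lt_div_iff₀ hs1]; linarith
  have hs0 : 0 < s := by linarith
  obtain ⟨C1, hC1, H1⟩ := strong_Mc n s (by linarith)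
  obtain ⟨C2, hC2, H2⟩ := strong_Mc n (s / (s - 1)) hs'
  have hκ0 : volume (Metric.ball (0 : Euc n) 1) ≠ 0 :=
    (Metric.measure_ball_pos volume _ one_pos).ne'
  set A : ℝ≥0∞ := (3 ^ n) ^ (s - 1) * 3 ^ n * (volume (Metric.ball (0 : Euc n) 1))⁻¹ with hA
  have hAt : A ≠ ⊤ := by
    have h1 : ((3 : ℝ≥0∞) ^ n) ^ (s - 1) ≠ ⊤ := ENNReal.rpow_ne_top_of_nonneg hs1.le (by finiteness)
    have h2 : (volume (Metric.ball (0 : Euc n) 1))⁻¹ ≠ ⊤ := ENNReal.inv_ne_top.2 hκ0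
    rw [hA]
    exact ENNReal.mul_ne_top (ENNReal.mul_ne_top h1 (by finiteness)) h2
  refine ⟨A ^ (s / (s - 1)) * C2 * C1, ?_, ?_⟩
  · exact ENNReal.mul_ne_top (ENNReal.mul_ne_top
      (ENNReal.rpow_ne_top_of_nonneg (by positivity) hAt) hC2) hC1
  intro W hW hW0 hWt K hK HB E hE
  set μu := volume.withDensity fun x => W x ^ q with hμu
  set μσ := volume.withDensity fun x => W x ^ (-P) with hμσ
  set m := Mc μu (E.indicator 1) with hm
  have hmm : Measurable m := measurable_Mc _ _ (measurable_one.indicator hE)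
  set h := fun x => m x ^ (s - 1) * W x ^ P with hh
  have hhm : Measurable h := (hmm.pow_const _).mul (hW.pow_const _)
  have hpt : ∀ y, Mo (μu.restrict E) y ≤ (A * K ^ (s - 1) * Mc μσ h y) ^ (s - 1)⁻¹ := by
    intro y
    refine iSup_le fun r => ?_
    rw [ENNReal.le_rpow_inv_iff hs1]
    exact lerner_r hq hP hs W hW hW0 hWt K hK HB E hE y r
  have hpt2 : ∀ y, Mo (μu.restrict E) y ^ s ≤
      A ^ (s / (s - 1)) * K ^ s * Mc μσ h y ^ (s / (s - 1)) := by
    intro y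
    refine (ENNReal.rpow_le_rpow (hpt y) hs0.le).trans (le_of_eq ?_)
    rw [← ENNReal.rpow_mul, inv_mul_eq_div, ENNReal.mul_rpow_of_nonneg _ _ (by positivity),
      ENNReal.mul_rpow_of_nonneg _ _ (by positivity), ← ENNReal.rpow_mul K,
      mul_div_cancel₀ _ hs1.ne']
  have hMcm : Measurable (Mc μσ h) := measurable_Mc _ _ hhm
  calc ∫⁻ y, W y ^ (-P) * Mo (μu.restrict E) y ^ s
      ≤ ∫⁻ y, A ^ (s / (s - 1)) * K ^ s * (W y ^ (-P) * Mc μσ h y ^ (s / (s - 1))) := by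
        refine lintegral_mono fun y => ?_
        refine (mul_le_mul_right (hpt2 y) _).trans (le_of_eq ?_)
        ring
    _ = A ^ (s / (s - 1)) * K ^ s * ∫⁻ y, Mc μσ h y ^ (s / (s - 1)) ∂μσ := by
        rw [lintegral_const_mul _ (by fun_prop), hμσ,
          lintegral_withDensity_eq_lintegral_mul _ (hW.pow_const _) (hMcm.pow_const _)]
        rfl
    _ ≤ A ^ (s / (s - 1)) * K ^ s * (C2 * ∫⁻ y, h y ^ (s / (s - 1)) ∂μσ) :=
        mul_le_mul_right (H2 μσ h hhm) _
    _ = A ^ (s / (s - 1)) * K ^ s * (C2 * ∫⁻ y, m y ^ s ∂μu) := by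
        congr 2
        rw [hμσ, hμu, lintegral_withDensity_eq_lintegral_mul _ (hW.pow_const _) (hhm.pow_const _),
          lintegral_withDensity_eq_lintegral_mul _ (hW.pow_const _) (hmm.pow_const _)]
        refine lintegral_congr_ae ?_
        filter_upwards [hW0] with x hx
        simp only [Pi.mul_apply, hh]
        rw [ENNReal.mul_rpow_of_nonneg _ _ (by positivity), ← ENNReal.rpow_mul, ← ENNReal.rpow_mul,
          mul_div_cancel₀ _ hs1.ne', mul_left_comm, ← ENNReal.rpow_add _ _ hx (hWt x), mul_comm]
        congr 2
        have e1 : s - 1 = P / q := by rw [hs]; ring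
        have e2 : s / (s - 1) = 1 + q / P := by rw [e1, hs]; field_simp; ring
        rw [e2]; field_simp; ring
    _ ≤ A ^ (s / (s - 1)) * K ^ s * (C2 * (C1 * ∫⁻ y, (E.indicator 1 : Euc n → ℝ≥0∞) y ^ s ∂μu)) :=
        mul_le_mul_right (mul_le_mul_right (H1 μu _ (measurable_one.indicator hE)) _) _
    _ = A ^ (s / (s - 1)) * K ^ s * (C2 * (C1 * μu E)) := by
        congr 3
        rw [← lintegral_indicator_one hE]
        refine lintegral_congr fun x => ?_
        by_cases hx : x ∈ E <;> simp [hx, hs0]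
    _ = _ := by ring

theorem measurable_riesz (α : ℝ) (f : Euc n → ℝ) (hf : Measurable f) : Measurable (riesz α f) := by
  unfold riesz
  refine Measurable.lintegral_prod_right' (f := fun z : Euc n × Euc n =>
    ENNReal.ofReal |f z.2| * ENNReal.ofReal (‖z.1 - z.2‖ ^ (α - (n : ℝ)))) ?_
  have : Measurable fun z : Euc n × Euc n => |f z.2| := (hf.comp measurable_snd).norm
  fun_prop

theorem core_E (hn : 0 < n) {α q : ℝ} (hα : 0 < α) (hαn : α < n)
    (μ : Measure (Euc n)) [SFinite μ] (f : Euc n → ℝ) (hf : Measurable f) (A : ℝ≥0∞)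
    (E : Set (Euc n)) (hE : MeasurableSet E) (h0 : μ E ≠ 0) (ht : μ E ≠ ⊤)
    (H : ∫⁻ y, ENNReal.ofReal |f y| * Mo (μ.restrict E) y ^ (1 - α / n) ≤
        A * μ E ^ (1 - α / n - 1 / q)) (t : ℝ)
    (hEt : ∀ x ∈ E, ENNReal.ofReal t < riesz α f x) :
    ENNReal.ofReal t * μ E ^ (1 / q) ≤ ENNReal.ofReal ((n - α) * 2 ^ n / α + 1) * A := by
  set c := ENNReal.ofReal ((n - α) * 2 ^ n / α + 1) with hc
  have hfm : Measurable fun y => ENNReal.ofReal |f y| := by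
    have : Measurable fun z : Euc n => |f z| := hf.norm
    fun_prop
  have hMom : Measurable (Mo (μ.restrict E)) := measurable_Mo _
  have key : ENNReal.ofReal t * μ E ≤ c * A * μ E ^ (1 - 1 / q) := by
    calc ENNReal.ofReal t * μ E = ∫⁻ x in E, ENNReal.ofReal t ∂μ := by rw [setLIntegral_const]
      _ ≤ ∫⁻ x in E, riesz α f x ∂μ := setLIntegral_mono' hE fun x hx => (hEt x hx).le
      _ = ∫⁻ y, (∫⁻ x in E, ENNReal.ofReal |f y| * ENNReal.ofReal (‖x - y‖ ^ (α - (n : ℝ))) ∂μ) := by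
          unfold riesz
          refine lintegral_lintegral_swap ?_
          have : Measurable fun z : Euc n × Euc n => |f z.2| := (hf.comp measurable_snd).norm
          have : Measurable fun z : Euc n × Euc n =>
            ENNReal.ofReal |f z.2| * ENNReal.ofReal (‖z.1 - z.2‖ ^ (α - (n : ℝ))) := by fun_prop
          exact this.aemeasurable
      _ ≤ ∫⁻ y, (c * μ E ^ (α / n)) * (ENNReal.ofReal |f y| * Mo (μ.restrict E) y ^ (1 - α / n)) := by
          refine lintegral_mono fun y => ?_
          have hh := hedberg hn hα hαn (μ.restrict E) (by simpa using h0) (by simpa using ht) y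
          rw [Measure.restrict_apply_univ] at hh
          rw [lintegral_const_mul' _ _ (by finiteness)]
          refine (mul_le_mul_right hh _).trans (le_of_eq ?_)
          ring
      _ = (c * μ E ^ (α / n)) * ∫⁻ y, ENNReal.ofReal |f y| * Mo (μ.restrict E) y ^ (1 - α / n) := by
          rw [lintegral_const_mul _ (by fun_prop)]
      _ ≤ (c * μ E ^ (α / n)) * (A * μ E ^ (1 - α / n - 1 / q)) := by gcongr
      _ = c * A * (μ E ^ (α / n) * μ E ^ (1 - α / n - 1 / q)) := by ring
      _ = _ := by
          rw [← ENNReal.rpow_add _ _ h0 ht]; congr 2; ring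
  calc ENNReal.ofReal t * μ E ^ (1 / q) = ENNReal.ofReal t * μ E * μ E ^ (1 / q - 1) := by
        rw [mul_assoc]; congr 1
        nth_rewrite 2 [← ENNReal.rpow_one (μ E)]
        rw [← ENNReal.rpow_add _ _ h0 ht]; congr 1; ring
    _ ≤ c * A * μ E ^ (1 - 1 / q) * μ E ^ (1 / q - 1) := by gcongr
    _ = _ := by
        rw [mul_assoc (c * A), ← ENNReal.rpow_add _ _ h0 ht]; simp

theorem core (hn : 0 < n) {α q : ℝ} (hα : 0 < α) (hαn : α < n) (hq : 0 < q)
    (μ : Measure (Euc n)) [SFinite μ] (hfin : ∀ k : ℕ, μ (Metric.closedBall 0 k) ≠ ⊤)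
    (f : Euc n → ℝ) (hf : Measurable f) (A : ℝ≥0∞)
    (H : ∀ E, MeasurableSet E → μ E ≠ 0 → μ E ≠ ⊤ →
      ∫⁻ y, ENNReal.ofReal |f y| * Mo (μ.restrict E) y ^ (1 - α / n) ≤
        A * μ E ^ (1 - α / n - 1 / q)) (t : ℝ) (ht : 0 < t) :
    ENNReal.ofReal t * μ {x | ENNReal.ofReal t < riesz α f x} ^ (1 / q) ≤
      ENNReal.ofReal ((n - α) * 2 ^ n / α + 1) * A := by
  set X := ENNReal.ofReal ((n - α) * 2 ^ n / α + 1) * A with hX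
  set T := {x | ENNReal.ofReal t < riesz α f x} with hT
  have hTm : MeasurableSet T := measurableSet_lt measurable_const (measurable_riesz α f hf)
  have ht0 : ENNReal.ofReal t ≠ 0 := by simpa using ht
  have iff : ∀ V : ℝ≥0∞, ENNReal.ofReal t * V ^ (1 / q) ≤ X ↔ V ≤ (X / ENNReal.ofReal t) ^ q := by
    intro V
    rw [mul_comm, ← ENNReal.le_div_iff_mul_le (Or.inl ht0) (Or.inl (by simp)), one_div,
      ENNReal.rpow_inv_le_iff hq]
  rw [iff]
  have hU : T = ⋃ k : ℕ, T ∩ Metric.closedBall 0 k := by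
    rw [← inter_iUnion, Metric.iUnion_closedBall_nat, inter_univ]
  have hmono : Monotone fun k : ℕ => T ∩ Metric.closedBall (0 : Euc n) k := by
    intro a b hab
    exact inter_subset_inter_right _ (Metric.closedBall_subset_closedBall (by exact_mod_cast hab))
  rw [hU, hmono.measure_iUnion]
  refine iSup_le fun k => ?_
  by_cases h0 : μ (T ∩ Metric.closedBall (0 : Euc n) k) = 0
  · rw [h0]; exact zero_le
  have hEm : MeasurableSet (T ∩ Metric.closedBall (0 : Euc n) k) :=
    hTm.inter Metric.isClosed_closedBall.measurableSet
  have htop : μ (T ∩ Metric.closedBall (0 : Euc n) k) ≠ ⊤ :=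
    ne_top_of_le_ne_top (hfin k) (measure_mono inter_subset_right)
  rw [← iff]
  exact core_E hn hα hαn μ f hf A _ hEm h0 htop (H _ hEm h0 htop) t fun x hx => hx.1



theorem fin_of_HB {q P : ℝ} (hq : 0 < q) (hP : 0 < P)
    (W : Euc n → ℝ≥0∞) (hW : Measurable W) (hWt : ∀ x, W x ≠ ⊤)
    (K : ℝ≥0∞) (hK : K ≠ ⊤)
    (HB : ∀ (y : Euc n) (r : ℝ), 0 < r →
      ((ENNReal.ofReal (r ^ n))⁻¹ * ∫⁻ x in Metric.closedBall y r, W x ^ q) *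
      ((ENNReal.ofReal (r ^ n))⁻¹ * ∫⁻ x in Metric.closedBall y r, W x ^ (-P)) ^ (q / P) ≤ K)
    (y : Euc n) (r : ℝ) (hr : 0 < r) :
    ∫⁻ x in Metric.closedBall y r, W x ^ q ≠ ⊤ := by
  intro h
  have hHB := HB y r hr
  have hBm : MeasurableSet (Metric.closedBall y r) := Metric.isClosed_closedBall.measurableSet
  have hS0 : ∫⁻ x in Metric.closedBall y r, W x ^ (-P) ≠ 0 := by
    intro h
    rw [setLIntegral_eq_zero_iff hBm (hW.pow_const _)] at h
    apply (Metric.measure_closedBall_pos (volume : Measure (Euc n)) y hr).ne'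
    rw [measure_eq_zero_iff_ae_notMem]
    filter_upwards [h] with x h1 h3
    have := h1 h3
    rw [ENNReal.rpow_eq_zero_iff] at this
    rcases this with h | h
    · linarith [h.2]
    · exact hWt x h.1
  rw [h, ENNReal.mul_top (by simp), ENNReal.top_mul] at hHB
  · exact hK (top_le_iff.1 hHB)
  · rw [Ne, ENNReal.rpow_eq_zero_iff_of_pos (by positivity), mul_eq_zero]
    simp [hS0]

theorem ae_ne_zero_of_HB {q P : ℝ} (hq : 0 < q) (hP : 0 < P)
    (W : Euc n → ℝ≥0∞) (hW : Measurable W)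
    (K : ℝ≥0∞) (hK : K ≠ ⊤)
    (HB : ∀ (y : Euc n) (r : ℝ), 0 < r →
      ((ENNReal.ofReal (r ^ n))⁻¹ * ∫⁻ x in Metric.closedBall y r, W x ^ q) *
      ((ENNReal.ofReal (r ^ n))⁻¹ * ∫⁻ x in Metric.closedBall y r, W x ^ (-P)) ^ (q / P) ≤ K)
    (E : Set (Euc n))
    (h0 : (volume.withDensity fun x => W x ^ q) E ≠ 0) : ∀ᵐ x, W x ≠ 0 := by
  have h1 : ∃ k : ℕ, (volume.withDensity fun x => W x ^ q) (Metric.closedBall 0 k) ≠ 0 := by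
    by_contra! hcon
    apply h0
    refine measure_mono_null (subset_univ E) ?_
    rw [← Metric.iUnion_closedBall_nat (0 : Euc n), measure_iUnion_null_iff]
    exact hcon
  obtain ⟨k0, hk0⟩ := h1
  have h2 : ∀ k : ℕ, ∀ᵐ x, x ∈ Metric.closedBall (0 : Euc n) ((k0 + k + 1 : ℕ) : ℝ) → W x ≠ 0 := by
    intro k
    have hr : (0 : ℝ) < ((k0 + k + 1 : ℕ) : ℝ) := by positivity
    have hHB := HB 0 _ hr
    set B := Metric.closedBall (0 : Euc n) ((k0 + k + 1 : ℕ) : ℝ) with hB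
    have hBm : MeasurableSet B := Metric.isClosed_closedBall.measurableSet
    have hU : ∫⁻ x in B, W x ^ q ≠ 0 := by
      rw [← withDensity_apply _ hBm]
      intro hc
      apply hk0
      refine measure_mono_null (Metric.closedBall_subset_closedBall ?_) hc
      push_cast; linarith [(Nat.cast_nonneg k : (0 : ℝ) ≤ k)]
    have hS : ∫⁻ x in B, W x ^ (-P) ≠ ⊤ := by
      intro h
      rw [h, ENNReal.mul_top (by simp), ENNReal.top_rpow_of_pos (by positivity),
        ENNReal.mul_top] at hHB
      · exact hK (top_le_iff.1 hHB)
      · simp [hU]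
    have := ae_lt_top (hW.pow_const (-P)) hS
    rw [ae_restrict_iff' hBm] at this
    filter_upwards [this] with x hx hxB hW0
    have := hx hxB
    rw [hW0, ENNReal.zero_rpow_of_neg (by linarith)] at this
    exact lt_irrefl _ this
  rw [← ae_all_iff] at h2
  filter_upwards [h2] with x hx
  obtain ⟨k, hk⟩ := exists_nat_ge ‖x‖
  refine hx k ?_
  rw [mem_closedBall_zero_iff]
  push_cast
  linarith [(Nat.cast_nonneg k0 : (0 : ℝ) ≤ k0)]

theorem main_gt (n : ℕ) (hn : 0 < n) (α p q : ℝ) (hα : 0 < α) (hαn : α < n)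
    (hp : 1 < p) (hq0 : 0 < q) (hq : 1 / q = 1 / p - α / n) :
    ∃ c : ℝ≥0∞, c ≠ ⊤ ∧ ∀ w f : Euc n → ℝ, Measurable w → Measurable f →
      Apq p q w < ⊤ → ∀ t : ℝ, 0 < t →
      ENNReal.ofReal t * (volume.withDensity fun x => ENNReal.ofReal (w x) ^ q)
        {x | ENNReal.ofReal t < riesz α f x} ^ (1 / q) ≤
        c * Apq p q w ^ (1 - α / n) * wLp w f p := by
  have hn' : (0 : ℝ) < n := by exact_mod_cast hn
  set P := dualExp p with hPdef
  have hp1 : 0 < p - 1 := by linarith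
  have hP : 0 < P := by rw [hPdef, dualExp]; positivity
  have hpP : p.HolderConjugate P := Real.HolderConjugate.conjExponent hp
  have hPinv : 1 / P = 1 - 1 / p := by
    rw [hPdef, dualExp]; field_simp
  have hθ : 0 < 1 - α / n := by rw [sub_pos, div_lt_one hn']; exact hαn
  set θ := 1 - α / n with hθdef
  have hθ1 : θ - 1 / q = 1 / P := by rw [hq, hPinv]; ring
  set s := 1 + P / q with hs
  have hsθ : s = θ * P := by
    have : θ = 1 / P + 1 / q := by linarith
    rw [this, hs]; field_simp
  obtain ⟨C, hC, HC⟩ := buckley n hq0 hP hs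
  set D : ℝ≥0∞ := 2 ^ n * (2 ^ n) ^ (q / P) with hD
  have hDt : D ≠ ⊤ := ENNReal.mul_ne_top (by finiteness)
    (ENNReal.rpow_ne_top_of_nonneg (by positivity) (by finiteness))
  refine ⟨ENNReal.ofReal ((n - α) * 2 ^ n / α + 1) * (C ^ (1 / P) * D ^ θ), ?_, ?_⟩
  · exact ENNReal.mul_ne_top (by simp) (ENNReal.mul_ne_top
      (ENNReal.rpow_ne_top_of_nonneg (by positivity) hC)
      (ENNReal.rpow_ne_top_of_nonneg (by positivity) hDt))
  intro w f hw hf hA t ht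
  set W : Euc n → ℝ≥0∞ := fun x => ENNReal.ofReal (w x) with hWdef
  have hW : Measurable W := by fun_prop
  have hWt : ∀ x, W x ≠ ⊤ := fun x => by simp [hWdef]
  set K := Apq p q w with hKdef
  have hDK : D * K ≠ ⊤ := ENNReal.mul_ne_top hDt hA.ne
  have HB : ∀ (y : Euc n) (r : ℝ), 0 < r →
      ((ENNReal.ofReal (r ^ n))⁻¹ * ∫⁻ x in Metric.closedBall y r, W x ^ q) *
      ((ENNReal.ofReal (r ^ n))⁻¹ * ∫⁻ x in Metric.closedBall y r, W x ^ (-P)) ^ (q / P) ≤ D * K :=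
    fun y r hr => Apq_ball hp.ne' (by positivity) w y hr
  have hfin : ∀ k : ℕ, (volume.withDensity fun x => W x ^ q) (Metric.closedBall 0 k) ≠ ⊤ := by
    intro k
    have := fin_of_HB hq0 hP W hW hWt _ hDK HB 0 (k + 1) (by positivity)
    rw [withDensity_apply _ Metric.isClosed_closedBall.measurableSet]
    exact ne_top_of_le_ne_top this
      (lintegral_mono_set (Metric.closedBall_subset_closedBall (by linarith)))
  refine (core hn hα hαn hq0 (volume.withDensity fun x => W x ^ q) hfin f hf
    (C ^ (1 / P) * D ^ θ * K ^ θ * wLp w f p) ?_ t ht).trans (le_of_eq (by ring))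
  intro E hE h0 _
  have hW0 := ae_ne_zero_of_HB hq0 hP W hW _ hDK HB E h0
  have hBk := HC W hW hW0 hWt _ hDK HB E hE
  rw [← hθdef, hθ1]
  set μ := volume.withDensity fun x => W x ^ q with hμ
  have hMom : Measurable (Mo (μ.restrict E)) := measurable_Mo _
  have hfm : Measurable fun y => ENNReal.ofReal |f y| := by
    have : Measurable fun z : Euc n => |f z| := hf.norm
    fun_prop
  calc ∫⁻ y, ENNReal.ofReal |f y| * Mo (μ.restrict E) y ^ θ
      = ∫⁻ y, ((fun y => W y * ENNReal.ofReal |f y|) *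
          fun y => (W y)⁻¹ * Mo (μ.restrict E) y ^ θ) y := by
        refine lintegral_congr_ae ?_
        filter_upwards [hW0] with y hy
        simp only [Pi.mul_apply]
        calc _ = (W y * (W y)⁻¹) * (ENNReal.ofReal |f y| * Mo (μ.restrict E) y ^ θ) := by
              rw [ENNReal.mul_inv_cancel hy (hWt y), one_mul]
          _ = _ := by ring
    _ ≤ (∫⁻ y, (W y * ENNReal.ofReal |f y|) ^ p) ^ (1 / p) *
        (∫⁻ y, ((W y)⁻¹ * Mo (μ.restrict E) y ^ θ) ^ P) ^ (1 / P) :=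
        ENNReal.lintegral_mul_le_Lp_mul_Lq volume hpP (by fun_prop) (by fun_prop)
    _ = wLp w f p * (∫⁻ y, W y ^ (-P) * Mo (μ.restrict E) y ^ s) ^ (1 / P) := by
        congr 2
        refine lintegral_congr fun y => ?_
        rw [ENNReal.mul_rpow_of_nonneg _ _ hP.le, ← ENNReal.rpow_mul, hsθ, ENNReal.inv_rpow,
          ENNReal.rpow_neg]
    _ ≤ wLp w f p * (C * (D * K) ^ s * μ E) ^ (1 / P) := by gcongr
    _ = _ := by
        rw [ENNReal.mul_rpow_of_nonneg _ _ (by positivity),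
          ENNReal.mul_rpow_of_nonneg _ _ (by positivity), ← ENNReal.rpow_mul, hsθ,
          mul_assoc θ, mul_one_div_cancel hP.ne', mul_one, ENNReal.mul_rpow_of_nonneg _ _ hθ.le]
        ring

theorem A1_ae {q : ℝ} (hq : 0 < q) (w : Euc n → ℝ)
    (hK : Apq 1 q w < ⊤) : ∀ᵐ y, ∀ r : {r : ℚ // 0 < r},
      (∫⁻ x in Metric.closedBall y (r.1 : ℝ), ENNReal.ofReal (w x) ^ q) *
        (ENNReal.ofReal ((r.1 : ℝ) ^ n))⁻¹ ≤ 4 ^ n * Apq 1 q w * ENNReal.ofReal (w y) ^ q := by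
  have h1 : ∀ᵐ y : Euc n, ∀ (a : Fin n → ℚ) (r : {r : ℚ // 0 < r}),
      y ∈ Cube (WithLp.toLp 2 fun i => (a i : ℝ)) (4 * r.1) →
      (volume (Cube (n := n) (WithLp.toLp 2 fun i => (a i : ℝ)) (4 * r.1)))⁻¹ *
        ∫⁻ x in Cube (WithLp.toLp 2 fun i => (a i : ℝ)) (4 * r.1), ENNReal.ofReal (w x) ^ q ≤
        Apq 1 q w * ENNReal.ofReal (w y) ^ q := by
    rw [ae_all_iff]; intro a
    rw [ae_all_iff]; intro r
    have hr : (0 : ℝ) < r.1 := by exact_mod_cast r.2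
    rw [← ae_restrict_iff' (cube_meas _ _)]
    set Q := Cube (n := n) (WithLp.toLp 2 fun i => (a i : ℝ)) (4 * r.1) with hQ
    have hApq : ((volume Q)⁻¹ * ∫⁻ x in Q, ENNReal.ofReal (w x) ^ q) *
        (essSup (fun x => (ENNReal.ofReal (w x))⁻¹) (volume.restrict Q)) ^ q ≤ Apq 1 q w := by
      conv_rhs => unfold Apq
      simp only [if_true]
      exact le_iSup_of_le _ (le_iSup_of_le (4 * r.1) (le_iSup_of_le (by positivity) le_rfl))
    filter_upwards [ENNReal.ae_le_essSup (μ := volume.restrict Q)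
      (fun x => (ENNReal.ofReal (w x))⁻¹)] with y hy
    rw [← ENNReal.div_le_iff_le_mul (Or.inr hK.ne)
      (Or.inl (ENNReal.rpow_ne_top_of_nonneg hq.le (by simp)))]
    refine le_trans ?_ hApq
    rw [div_eq_mul_inv, ← ENNReal.inv_rpow]
    gcongr
  filter_upwards [h1] with y hy r
  have hr : (0 : ℝ) < r.1 := by exact_mod_cast r.2
  have hex : ∀ i, ∃ a : ℚ, y i - 2 * (r.1 : ℝ) < a ∧ (a : ℝ) < y i - r.1 :=
    fun i => exists_rat_btwn (by linarith)
  choose a ha1 ha2 using hex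
  have hsub : Metric.closedBall y (r.1 : ℝ) ⊆
      Cube (WithLp.toLp 2 fun i => (a i : ℝ)) (4 * r.1) := by
    intro x hx i
    have h := ball_subset_cube y (r.1 : ℝ) hx i
    have h1 : y i - r.1 ≤ x i := h.1
    have h2 : x i ≤ y i - r.1 + 2 * r.1 := h.2
    change (a i : ℝ) ≤ x i ∧ x i ≤ a i + 4 * r.1
    constructor
    · linarith [ha2 i]
    · linarith [ha1 i]
  have hyQ := hy a r (hsub (Metric.mem_closedBall_self hr.le))
  rw [cube_volume _ (by positivity)] at hyQ
  have e4 : ENNReal.ofReal ((4 : ℝ) ^ n) = 4 ^ n := by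
    rw [ENNReal.ofReal_pow (by norm_num)]; simp
  calc _ ≤ (∫⁻ x in Cube (WithLp.toLp 2 fun i => (a i : ℝ)) (4 * r.1), ENNReal.ofReal (w x) ^ q) *
        (ENNReal.ofReal ((r.1 : ℝ) ^ n))⁻¹ := by gcongr
    _ = 4 ^ n * ((ENNReal.ofReal ((4 * r.1 : ℝ) ^ n))⁻¹ *
        ∫⁻ x in Cube (WithLp.toLp 2 fun i => (a i : ℝ)) (4 * r.1), ENNReal.ofReal (w x) ^ q) := by
        rw [mul_pow, ENNReal.ofReal_mul (by positivity),
          ENNReal.mul_inv (Or.inr (by simp)) (Or.inl (by simp)), e4, ← mul_assoc, ← mul_assoc,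
          ENNReal.mul_inv_cancel (by simp) (by finiteness), one_mul, mul_comm]
    _ ≤ 4 ^ n * (Apq 1 q w * ENNReal.ofReal (w y) ^ q) := by gcongr
    _ = _ := by ring

theorem main_one (n : ℕ) (hn : 0 < n) (α q : ℝ) (hα : 0 < α) (hαn : α < n)
    (hq0 : 0 < q) (hq : 1 / q = 1 - α / n) :
    ∃ c : ℝ≥0∞, c ≠ ⊤ ∧ ∀ w f : Euc n → ℝ, Measurable w → Measurable f →
      Apq 1 q w < ⊤ → ∀ t : ℝ, 0 < t →
      ENNReal.ofReal t * (volume.withDensity fun x => ENNReal.ofReal (w x) ^ q)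
        {x | ENNReal.ofReal t < riesz α f x} ^ (1 / q) ≤
        c * Apq 1 q w ^ (1 - α / n) * wLp w f 1 := by
  have hn' : (0 : ℝ) < n := by exact_mod_cast hn
  have hθ : 0 < 1 - α / n := by rw [sub_pos, div_lt_one hn']; exact hαn
  set θ := 1 - α / n with hθdef
  have hqθ : q * θ = 1 := by rw [← hq]; field_simp
  refine ⟨ENNReal.ofReal ((n - α) * 2 ^ n / α + 1) * (4 ^ n) ^ θ, ?_, ?_⟩
  · exact ENNReal.mul_ne_top (by simp)
      (ENNReal.rpow_ne_top_of_nonneg hθ.le (by finiteness))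
  intro w f hw hf hA t ht
  set W : Euc n → ℝ≥0∞ := fun x => ENNReal.ofReal (w x) with hWdef
  have hW : Measurable W := by fun_prop
  have hWt : ∀ x, W x ≠ ⊤ := fun x => by simp [hWdef]
  have hae := A1_ae hq0 w hA
  set K := Apq 1 q w with hKdef
  have hfin : ∀ k : ℕ, (volume.withDensity fun x => W x ^ q) (Metric.closedBall 0 k) ≠ ⊤ := by
    intro k
    obtain ⟨y, hy⟩ := hae.exists
    obtain ⟨R, hR1, -⟩ := exists_rat_btwn (show (k : ℝ) + ‖y‖ < k + ‖y‖ + 1 by linarith)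
    have hR0 : (0 : ℝ) < R := lt_of_le_of_lt (by positivity) hR1
    have := hy ⟨R, by exact_mod_cast hR0⟩
    rw [withDensity_apply _ Metric.isClosed_closedBall.measurableSet]
    have h2 : ∫⁻ x in Metric.closedBall y (R : ℝ), W x ^ q ≠ ⊤ := by
      intro h
      change (∫⁻ x in Metric.closedBall y (R : ℝ), W x ^ q) * _ ≤ _ at this
      rw [h, ENNReal.top_mul (by simp), top_le_iff] at this
      exact ENNReal.mul_ne_top (ENNReal.mul_ne_top (by finiteness) hA.ne)
        (ENNReal.rpow_ne_top_of_nonneg hq0.le (by simp)) this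
    refine ne_top_of_le_ne_top h2 (lintegral_mono_set (Metric.closedBall_subset_closedBall' ?_))
    rw [dist_zero_left]; exact hR1.le
  refine (core hn hα hαn hq0 (volume.withDensity fun x => W x ^ q) hfin f hf
    ((4 ^ n) ^ θ * K ^ θ * wLp w f 1) ?_ t ht).trans (le_of_eq (by ring))
  intro E hE h0 _
  rw [← hθdef, ← hq, sub_self, ENNReal.rpow_zero, mul_one, hq]
  set μ := volume.withDensity fun x => W x ^ q with hμ
  have hfm : Measurable fun y => ENNReal.ofReal |f y| := by
    have : Measurable fun z : Euc n => |f z| := hf.norm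
    fun_prop
  calc ∫⁻ y, ENNReal.ofReal |f y| * Mo (μ.restrict E) y ^ θ
      ≤ ∫⁻ y, ((4 ^ n) ^ θ * K ^ θ) * (W y * ENNReal.ofReal |f y|) := by
        refine lintegral_mono_ae ?_
        filter_upwards [hae] with y hy
        have hMo : Mo (μ.restrict E) y ≤ 4 ^ n * K * W y ^ q := by
          refine iSup_le fun r => le_trans ?_ (hy r)
          gcongr
          rw [← withDensity_apply _ Metric.isClosed_closedBall.measurableSet]
          exact Measure.restrict_apply_le _ _
        calc _ ≤ ENNReal.ofReal |f y| * (4 ^ n * K * W y ^ q) ^ θ := by gcongr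
          _ = _ := by
            rw [ENNReal.mul_rpow_of_nonneg _ _ hθ.le, ENNReal.mul_rpow_of_nonneg _ _ hθ.le,
              ← ENNReal.rpow_mul, hqθ, ENNReal.rpow_one]
            ring
    _ = ((4 ^ n) ^ θ * K ^ θ) * ∫⁻ y, W y * ENNReal.ofReal |f y| := by
        rw [lintegral_const_mul _ (by fun_prop)]
    _ = _ := by
        simp [wLp, hWdef]



/-- Sharp weak-type bound for the Riesz potential (Theorem 2.4). -/
theorem riesz_weak_type_sharp_bound
    (n : ℕ) (hn : 0 < n) (α p q : ℝ) (hα : 0 < α) (hαn : α < n)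
    (hp : 1 ≤ p) (hpn : p < n / α) (hq : 1 / q = 1 / p - α / n) :
    ∃ c : ℝ, 0 < c ∧ ∀ w f : Euc n → ℝ, Measurable w → (∀ x, 0 ≤ w x) → Measurable f →
      Apq p q w < ⊤ →
      weakLpE (fun x => w x ^ q) (riesz α f) q ≤
        ENNReal.ofReal c * Apq p q w ^ (1 - α / n) * wLp w f p := by
  have hn' : (0 : ℝ) < n := by exact_mod_cast hn
  have hp0 : 0 < p := by linarith
  have hq0 : 0 < q := by
    have h1 : 0 < 1 / q := by
      rw [hq, sub_pos, div_lt_div_iff₀ hn' hp0]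
      rw [lt_div_iff₀ hα] at hpn
      linarith
    exact one_div_pos.1 h1
  have hmain : ∃ c : ℝ≥0∞, c ≠ ⊤ ∧ ∀ w f : Euc n → ℝ, Measurable w → Measurable f →
      Apq p q w < ⊤ → ∀ t : ℝ, 0 < t →
      ENNReal.ofReal t * (volume.withDensity fun x => ENNReal.ofReal (w x) ^ q)
        {x | ENNReal.ofReal t < riesz α f x} ^ (1 / q) ≤
        c * Apq p q w ^ (1 - α / n) * wLp w f p := by
    rcases hp.eq_or_lt with h | h
    · subst h
      exact main_one n hn α q hα hαn hq0 (by rw [hq]; norm_num)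
    · exact main_gt n hn α p q hα hαn h hq0 hq
  obtain ⟨c, hc, H⟩ := hmain
  refine ⟨c.toReal + 1, by positivity, ?_⟩
  intro w f hw hw0 hf hA
  have hcc : c ≤ ENNReal.ofReal (c.toReal + 1) := by
    conv_lhs => rw [← ENNReal.ofReal_toReal hc]
    exact ENNReal.ofReal_le_ofReal (by linarith)
  unfold weakLpE
  refine iSup_le fun t => iSup_le fun ht => ?_
  have hTm : MeasurableSet {x | ENNReal.ofReal t < riesz α f x} :=
    measurableSet_lt measurable_const (measurable_riesz α f hf)
  have e : wMeas (fun x => w x ^ q) {x | ENNReal.ofReal t < riesz α f x} =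
      (volume.withDensity fun x => ENNReal.ofReal (w x) ^ q)
        {x | ENNReal.ofReal t < riesz α f x} := by
    rw [withDensity_apply _ hTm, wMeas]
    refine lintegral_congr fun x => ?_
    rw [ENNReal.ofReal_rpow_of_nonneg (hw0 x) hq0.le]
  rw [e]
  refine (H w f hw hf hA t ht).trans ?_
  gcongr



end
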